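/- Let f : ℝ³ → ℝ⁵ be a smooth map with f(0) = 0 that is A²-equivalent to g₁(x,y,z) = (x,y,xz,yz,z²). Then there exist a smooth map ψ : ℝ³ → ℝ³ with ψ(0) = 0 and invertible Fréchet derivative at 0, a linear isometry A of ℝ⁵, and real constants a₁, a₃, a₆, b₁, b₂, b₃, b₆, c₁, c₂, c₃, c₄, c₅, c₆ with c₄ > 0 and b₆ ≠ 0, such that the iterated Fréchet derivatives at 0 of A ∘ f ∘ ψ, for all orders k ≤ 2, coincide with those of the polynomial map (x,y,z) ↦ (x, y, a₁x² + a₃y² + xz + a₆yz, b₁x² + b₂xy + b₃y² + b₆yz, c₁x² + c₂xy + c₃y² + c₄z² + c₅xz + c₆yz). -/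

import Mathlib

noncomputable section

/-- `𝒜²`-equivalence of smooth map germs `(ℝ³,0) → (ℝ⁵,0)`. -/
def A2Equiv (f g : EuclideanSpace ℝ (Fin 3) → EuclideanSpace ℝ (Fin 5)) : Prop :=
  ∃ (ψ : EuclideanSpace ℝ (Fin 3) → EuclideanSpace ℝ (Fin 3))
    (φ : EuclideanSpace ℝ (Fin 5) → EuclideanSpace ℝ (Fin 5))
    (ψ' : EuclideanSpace ℝ (Fin 3) ≃L[ℝ] EuclideanSpace ℝ (Fin 3))
    (φ' : EuclideanSpace ℝ (Fin 5) ≃L[ℝ] EuclideanSpace ℝ (Fin 5)),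
    ContDiff ℝ (⊤ : ℕ∞) ψ ∧ ContDiff ℝ (⊤ : ℕ∞) φ ∧ ψ 0 = 0 ∧ φ 0 = 0 ∧
    HasFDerivAt ψ (ψ' : EuclideanSpace ℝ (Fin 3) →L[ℝ] EuclideanSpace ℝ (Fin 3)) 0 ∧
    HasFDerivAt φ (φ' : EuclideanSpace ℝ (Fin 5) →L[ℝ] EuclideanSpace ℝ (Fin 5)) 0 ∧
    ∀ k : ℕ, k ≤ 2 → iteratedFDeriv ℝ k (φ ∘ f ∘ ψ) 0 = iteratedFDeriv ℝ k g 0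

/-- The 3-dimensional cross-cap normal form `(x,y,xz,yz,z²)`. -/
def g1 : EuclideanSpace ℝ (Fin 3) → EuclideanSpace ℝ (Fin 5) := fun p =>
  (WithLp.equiv 2 (Fin 5 → ℝ)).symm ![p 0, p 1, p 0 * p 2, p 1 * p 2, p 2 ^ 2]

section Jets

variable {E F G : Type*} [NormedAddCommGroup E] [NormedSpace ℝ E]
  [NormedAddCommGroup F] [NormedSpace ℝ F] [NormedAddCommGroup G] [NormedSpace ℝ G]

theorem iteratedFDeriv_eq_of_le_two_iff {f g : E → F} {x : E} :
    (∀ k : ℕ, k ≤ 2 → iteratedFDeriv ℝ k f x = iteratedFDeriv ℝ k g x) ↔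
      f x = g x ∧ (∀ u, fderiv ℝ f x u = fderiv ℝ g x u) ∧
        ∀ u v, fderiv ℝ (fderiv ℝ f) x u v = fderiv ℝ (fderiv ℝ g) x u v := by
  constructor
  · intro h
    refine ⟨?_, fun u => ?_, fun u v => ?_⟩
    · simpa using congrArg (fun m => m 0) (h 0 (by norm_num))
    · simpa [iteratedFDeriv_one_apply] using congrArg (fun m => m ![u]) (h 1 (by norm_num))
    · simpa [iteratedFDeriv_two_apply] using congrArg (fun m => m ![u, v]) (h 2 le_rfl)
  · rintro ⟨h0, h1, h2⟩ k hk
    ext m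
    interval_cases k
    · simpa using h0
    · simpa [iteratedFDeriv_one_apply] using h1 (m 0)
    · simpa [iteratedFDeriv_two_apply] using h2 (m 0) (m 1)

theorem fderiv_fderiv_comp {g : F → G} {f : E → F} (hg : ContDiff ℝ 2 g) (hf : ContDiff ℝ 2 f)
    (x u v : E) :
    fderiv ℝ (fderiv ℝ (g ∘ f)) x u v =
      fderiv ℝ (fderiv ℝ g) (f x) (fderiv ℝ f x u) (fderiv ℝ f x v) +
        fderiv ℝ g (f x) (fderiv ℝ (fderiv ℝ f) x u v) := by
  have hgd : Differentiable ℝ g := hg.differentiable (by norm_num)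
  have hfd : Differentiable ℝ f := hf.differentiable (by norm_num)
  have hgd' : Differentiable ℝ (fderiv ℝ g) :=
    (hg.fderiv_right (m := 1) (by norm_num)).differentiable (by norm_num)
  have hfd' : Differentiable ℝ (fderiv ℝ f) :=
    (hf.fderiv_right (m := 1) (by norm_num)).differentiable (by norm_num)
  have h1 : fderiv ℝ (g ∘ f) = fun y => (fderiv ℝ g (f y)).comp (fderiv ℝ f y) :=
    funext fun y => fderiv_comp y (hgd _) (hfd _)
  have h2 : HasFDerivAt (fun y => fderiv ℝ g (f y))
      ((fderiv ℝ (fderiv ℝ g) (f x)).comp (fderiv ℝ f x)) x :=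
    (hgd' (f x)).hasFDerivAt.comp x (hfd x).hasFDerivAt
  rw [h1, (h2.clm_comp (hfd' x).hasFDerivAt).fderiv]
  simp [add_comm]

/-- The polynomial map with linear part `T` and quadratic part `p ↦ ½ S(p, p)`. -/
def quadraticMap (T : E →L[ℝ] F) (S : E →L[ℝ] E →L[ℝ] F) (p : E) : F :=
  T p + (1 / 2 : ℝ) • S p p

theorem contDiff_quadraticMap (T : E →L[ℝ] F) (S : E →L[ℝ] E →L[ℝ] F) {n : WithTop ℕ∞} :
    ContDiff ℝ n (quadraticMap T S) := by
  unfold quadraticMap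
  fun_prop

theorem hasFDerivAt_quadraticMap (T : E →L[ℝ] F) (S : E →L[ℝ] E →L[ℝ] F) (p : E) :
    HasFDerivAt (quadraticMap T S) (T + (1 / 2 : ℝ) • (S + S.flip) p) p := by
  have h := T.hasFDerivAt.add
    ((S.hasFDerivAt_of_bilinear (hasFDerivAt_id p) (hasFDerivAt_id p)).const_smul (1 / 2 : ℝ))
  refine h.congr_fderiv ?_
  ext u
  simp

theorem fderiv_fderiv_quadraticMap (T : E →L[ℝ] F) (S : E →L[ℝ] E →L[ℝ] F) (p u v : E) :
    fderiv ℝ (fderiv ℝ (quadraticMap T S)) p u v = (1 / 2 : ℝ) • (S u v + S v u) := by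
  have h1 : fderiv ℝ (quadraticMap T S) = fun q => T + (1 / 2 : ℝ) • (S + S.flip) q :=
    funext fun q => (hasFDerivAt_quadraticMap T S q).fderiv
  have h2 : HasFDerivAt (fun q => T + (1 / 2 : ℝ) • (S + S.flip) q)
      ((1 / 2 : ℝ) • (S + S.flip)) p :=
    ((S + S.flip).hasFDerivAt.const_smul (1 / 2 : ℝ)).const_add T
  rw [h1, h2.fderiv]
  simp

end Jets

/-- The linear part of the cross-cap `g1`. -/
def crossCapLinear : EuclideanSpace ℝ (Fin 3) →L[ℝ] EuclideanSpace ℝ (Fin 5) :=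
  LinearMap.toContinuousLinearMap
    { toFun := fun p => WithLp.toLp 2 ![p 0, p 1, 0, 0, 0]
      map_add' := fun p q => by ext i; fin_cases i <;> simp
      map_smul' := fun c p => by ext i; fin_cases i <;> simp }

/-- A bilinear map whose diagonal is twice the quadratic part of the cross-cap `g1`. -/
def crossCapBilinear :
    EuclideanSpace ℝ (Fin 3) →L[ℝ] EuclideanSpace ℝ (Fin 3) →L[ℝ] EuclideanSpace ℝ (Fin 5) :=
  LinearMap.toContinuousBilinearMap <| LinearMap.mk₂ ℝ
    (fun u v => WithLp.toLp 2 ![0, 0, 2 * u 0 * v 2, 2 * u 1 * v 2, 2 * u 2 * v 2])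
    (fun u u' v => by ext i; fin_cases i <;> simp <;> ring)
    (fun c u v => by ext i; fin_cases i <;> simp <;> ring)
    (fun u v v' => by ext i; fin_cases i <;> simp <;> ring)
    (fun c u v => by ext i; fin_cases i <;> simp <;> ring)

theorem crossCapLinear_apply (p : EuclideanSpace ℝ (Fin 3)) :
    crossCapLinear p = WithLp.toLp 2 ![p 0, p 1, 0, 0, 0] := rfl

theorem crossCapBilinear_apply (u v : EuclideanSpace ℝ (Fin 3)) :
    crossCapBilinear u v =
      WithLp.toLp 2 ![0, 0, 2 * u 0 * v 2, 2 * u 1 * v 2, 2 * u 2 * v 2] := rfl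

theorem g1_eq_quadraticMap : g1 = quadraticMap crossCapLinear crossCapBilinear := by
  ext p i
  fin_cases i <;> simp [g1, quadraticMap, crossCapLinear_apply, crossCapBilinear_apply] <;> ring

/-- A germ `𝒜²`-equivalent to the cross-cap has a kernel direction `k` along which its second
derivative is transverse to the image of its differential. -/
theorem A2Equiv.exists_linearIndependent
    {f : EuclideanSpace ℝ (Fin 3) → EuclideanSpace ℝ (Fin 5)}
    (hf : ContDiff ℝ 2 f) (h0 : f 0 = 0) (hA2 : A2Equiv f g1) :
    ∃ X Y k : EuclideanSpace ℝ (Fin 3), fderiv ℝ f 0 k = 0 ∧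
      LinearIndependent ℝ ![fderiv ℝ f 0 X, fderiv ℝ f 0 Y, fderiv ℝ (fderiv ℝ f) 0 k k,
        fderiv ℝ (fderiv ℝ f) 0 X k, fderiv ℝ (fderiv ℝ f) 0 Y k] := by
  obtain ⟨ψ, φ, ψ', φ', hψ, hφ, hψ0, hφ0, hdψ, hdφ, hjet⟩ := hA2
  replace hψ : ContDiff ℝ 2 ψ := contDiff_infty.1 hψ 2
  replace hφ : ContDiff ℝ 2 φ := contDiff_infty.1 hφ 2
  obtain ⟨-, h1, h2⟩ := iteratedFDeriv_eq_of_le_two_iff.1 hjet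
  have hfψ : ContDiff ℝ 2 (f ∘ ψ) := hf.comp hψ
  have hd : fderiv ℝ (f ∘ ψ) 0 =
      (fderiv ℝ f 0).comp (ψ' : EuclideanSpace ℝ (Fin 3) →L[ℝ] EuclideanSpace ℝ (Fin 3)) := by
    rw [fderiv_comp 0 ((hf.differentiable (by norm_num)) _) hdψ.differentiableAt, hψ0, hdψ.fderiv]
  have hL : ∀ u, φ' (fderiv ℝ f 0 (ψ' u)) = crossCapLinear u := by
    intro u
    have := h1 u
    rw [fderiv_comp 0 ((hφ.differentiable (by norm_num)) _) ((hfψ.differentiable (by norm_num)) _),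
      g1_eq_quadraticMap, (hasFDerivAt_quadraticMap _ _ _).fderiv, hd] at this
    simpa [hψ0, h0, hdφ.fderiv] using this
  set e : EuclideanSpace ℝ (Fin 3) := EuclideanSpace.single 2 1 with he
  have hk : fderiv ℝ f 0 (ψ' e) = 0 := by
    apply φ'.injective
    rw [hL, map_zero]
    ext i
    fin_cases i <;> simp [crossCapLinear_apply, he]
  have hB : ∀ u, ∃ w, φ' (fderiv ℝ (fderiv ℝ f) 0 (ψ' u) (ψ' e)) =
      WithLp.toLp 2 ![0, 0, u 0, u 1, 2 * u 2] - crossCapLinear w := by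
    intro u
    have := h2 u e
    rw [fderiv_fderiv_comp hφ hfψ, fderiv_fderiv_comp hf hψ, g1_eq_quadraticMap,
      fderiv_fderiv_quadraticMap, hd] at this
    simp only [Function.comp_apply, hψ0, h0, hdφ.fderiv, hdψ.fderiv,
      ContinuousLinearMap.comp_apply, ContinuousLinearEquiv.coe_coe, hk, map_zero, zero_add,
      map_add] at this
    refine ⟨ψ'.symm (fderiv ℝ (fderiv ℝ ψ) 0 u e), ?_⟩
    rw [← hL, ψ'.apply_symm_apply, eq_sub_iff_add_eq, this]
    ext i
    fin_cases i <;> simp [crossCapBilinear_apply, he]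
    ring
  refine ⟨ψ' (EuclideanSpace.single 0 1), ψ' (EuclideanSpace.single 1 1), ψ' e, hk, ?_⟩
  obtain ⟨w0, hw0⟩ := hB (EuclideanSpace.single 0 1)
  obtain ⟨w1, hw1⟩ := hB (EuclideanSpace.single 1 1)
  obtain ⟨w2, hw2⟩ := hB e
  rw [Fintype.linearIndependent_iff]
  intro c hc
  have hc' := congrArg φ' hc
  simp only [Fin.sum_univ_five, Matrix.cons_val, map_add, map_smul, hL, hw0, hw1, hw2, map_zero]
    at hc'
  have hi := fun i => congrArg (fun v : EuclideanSpace ℝ (Fin 5) => v i) hc'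
  have i0 := hi 0
  have i1 := hi 1
  have i2 := hi 2
  have i3 := hi 3
  have i4 := hi 4
  simp [crossCapLinear_apply, he] at i0 i1 i2 i3 i4
  simp [i2, i3, i4] at i0 i1
  intro i
  fin_cases i <;> simp [i0, i1, i2, i3, i4]

theorem inner_gramSchmidtOrthonormalBasis_self_pos {ι V : Type*} [LinearOrder ι]
    [LocallyFiniteOrderBot ι] [WellFoundedLT ι] [Fintype ι] [NormedAddCommGroup V]
    [InnerProductSpace ℝ V] [FiniteDimensional ℝ V] (h : Module.finrank ℝ V = Fintype.card ι)
    {v : ι → V} (hv : LinearIndependent ℝ v) (i : ι) :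
    0 < inner ℝ (InnerProductSpace.gramSchmidtOrthonormalBasis h v i) (v i) := by
  have hne : InnerProductSpace.gramSchmidt ℝ v i ≠ 0 := InnerProductSpace.gramSchmidt_ne_zero i hv
  have hi : InnerProductSpace.gramSchmidtNormed ℝ v i ≠ 0 := by
    rw [← norm_ne_zero_iff, InnerProductSpace.gramSchmidtNormed_unit_length i hv]
    exact one_ne_zero
  have hself : inner ℝ (InnerProductSpace.gramSchmidt ℝ v i) (v i) =
      inner ℝ (InnerProductSpace.gramSchmidt ℝ v i) (InnerProductSpace.gramSchmidt ℝ v i) := by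
    conv_lhs => rw [InnerProductSpace.gramSchmidt_def'' ℝ v i]
    rw [inner_add_right, inner_sum, Finset.sum_eq_zero, add_zero]
    intro j hj
    rw [inner_smul_right, InnerProductSpace.gramSchmidt_orthogonal ℝ v (Finset.mem_Iio.1 hj).ne',
      mul_zero]
  rw [InnerProductSpace.gramSchmidtOrthonormalBasis_apply h hi,
    InnerProductSpace.gramSchmidtNormed, inner_smul_left, hself]
  have := real_inner_self_pos.2 hne
  have := norm_pos_iff.2 hne
  simp only [RCLike.ofReal_real_eq_id, id, conj_trivial]
  positivity

/-- The 2-jet `(L, B)` admits an orthonormal frame of the target and vectors in the source in which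
it takes the coefficients prescribed by the normal form. -/
theorem exists_adapted_orthonormalBasis {V W : Type*} [NormedAddCommGroup V] [NormedSpace ℝ V]
    [NormedAddCommGroup W] [InnerProductSpace ℝ W] [FiniteDimensional ℝ W]
    (hW : Module.finrank ℝ W = 5) (L : V →L[ℝ] W) (B : V →L[ℝ] V →L[ℝ] W)
    {X Y k : V} (hk : L k = 0) (hli : LinearIndependent ℝ ![L X, L Y, B k k, B X k, B Y k]) :
    ∃ (b : OrthonormalBasis (Fin 5) ℝ W) (X Y k : V),
      L X = b 0 ∧ L Y = b 1 ∧ L k = 0 ∧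
      inner ℝ (b 2) (B X k) = 1 ∧ inner ℝ (b 3) (B X k) = 0 ∧ inner ℝ (b 3) (B Y k) ≠ 0 ∧
      inner ℝ (b 2) (B k k) = 0 ∧ inner ℝ (b 3) (B k k) = 0 ∧ 0 < inner ℝ (b 4) (B k k) ∧
      inner ℝ (b 2) (B X Y) = 0 := by
  have hcard : Module.finrank ℝ W = Fintype.card (Fin 5) := by simpa using hW
  set v := ![L X, L Y, B k k, B X k, B Y k]
  set E := InnerProductSpace.gramSchmidtOrthonormalBasis hcard v
  have htri : ∀ i j : Fin 5, i < j → inner ℝ (E j) (v i) = 0 := fun i j hij =>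
    InnerProductSpace.gramSchmidtOrthonormalBasis_inv_triangular hcard v hij
  have hpos : ∀ i, 0 < inner ℝ (E i) (v i) := fun i =>
    inner_gramSchmidtOrthonormalBasis_self_pos hcard hli i
  have d0 : 0 < inner ℝ (E 0) (L X) := hpos 0
  have d1 : 0 < inner ℝ (E 1) (L Y) := hpos 1
  have d2 : 0 < inner ℝ (E 2) (B k k) := hpos 2
  have d3 : 0 < inner ℝ (E 3) (B X k) := hpos 3
  have d4 : 0 < inner ℝ (E 4) (B Y k) := hpos 4
  have t32 : inner ℝ (E 3) (B k k) = 0 := htri 2 3 (by decide)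
  have t42 : inner ℝ (E 4) (B k k) = 0 := htri 2 4 (by decide)
  have t43 : inner ℝ (E 4) (B X k) = 0 := htri 3 4 (by decide)
  have hLX : L X = inner ℝ (E 0) (L X) • E 0 := by
    conv_lhs => rw [← E.sum_repr' (L X)]
    have h1 : inner ℝ (E 1) (L X) = 0 := htri 0 1 (by decide)
    have h2 : inner ℝ (E 2) (L X) = 0 := htri 0 2 (by decide)
    have h3 : inner ℝ (E 3) (L X) = 0 := htri 0 3 (by decide)
    have h4 : inner ℝ (E 4) (L X) = 0 := htri 0 4 (by decide)
    simp [Fin.sum_univ_five, h1, h2, h3, h4]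
  have hLY : L Y = inner ℝ (E 0) (L Y) • E 0 + inner ℝ (E 1) (L Y) • E 1 := by
    conv_lhs => rw [← E.sum_repr' (L Y)]
    have h2 : inner ℝ (E 2) (L Y) = 0 := htri 1 2 (by decide)
    have h3 : inner ℝ (E 3) (L Y) = 0 := htri 1 3 (by decide)
    have h4 : inner ℝ (E 4) (L Y) = 0 := htri 1 4 (by decide)
    simp [Fin.sum_univ_five, h2, h3, h4]
  clear_value E v
  generalize inner ℝ (E 0) (L X) = p at *
  generalize inner ℝ (E 0) (L Y) = r at *
  generalize inner ℝ (E 1) (L Y) = q at *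
  have hX' : L (p⁻¹ • X) = E 0 := by
    rw [map_smul, hLX, smul_smul, inv_mul_cancel₀ d0.ne', one_smul]
  have hY' : L (q⁻¹ • (Y - r • p⁻¹ • X)) = E 1 := by
    rw [map_smul, map_sub, map_smul, hX', hLY, add_sub_cancel_left, smul_smul,
      inv_mul_cancel₀ d1.ne', one_smul]
  let σ : Fin 5 ≃ Fin 5 := ⟨![0, 1, 4, 2, 3], ![0, 1, 3, 4, 2], by decide, by decide⟩
  have hσ : ∀ i, E.reindex σ i = E (![0, 1, 3, 4, 2] i) := fun i => E.reindex_apply σ i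
  generalize hs : inner ℝ (E 3) (B X k) = s at *
  generalize ht : inner ℝ (E 4) (B Y k) = t at *
  generalize hu : inner ℝ (E 2) (B k k) = u at *
  obtain ⟨k', hk'⟩ : ∃ k', k' = (p * s⁻¹) • k := ⟨_, rfl⟩
  obtain ⟨Y', hY'_def⟩ : ∃ Y', Y' = q⁻¹ • (Y - r • p⁻¹ • X) := ⟨_, rfl⟩
  rw [← hY'_def] at hY'
  refine ⟨E.reindex σ, p⁻¹ • X, Y' - inner ℝ (E 3) (B (p⁻¹ • X) Y') • k', k', ?_⟩
  simp only [hσ, Matrix.cons_val]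
  have hXk : inner ℝ (E 3) (B (p⁻¹ • X) k') = 1 := by
    simp only [hk', map_smul, smul_apply, inner_smul_right, hs]
    field_simp
  refine ⟨hX', ?_, ?_, hXk, ?_, ?_, ?_, ?_, ?_, ?_⟩
  · simpa [hk', hk] using hY'
  · simp [hk', hk]
  · simp [hk', inner_smul_right, t43]
  · simp only [hk', hY'_def, map_smul, map_sub, smul_apply, sub_apply,
      inner_smul_right, inner_sub_right, t42, t43, ht, mul_zero, sub_zero]
    positivity
  · simp [hk', inner_smul_right, t32]
  · simp [hk', inner_smul_right, t42]
  · simp only [hk', map_smul, smul_apply, inner_smul_right, hu]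
    positivity
  · rw [map_sub, map_smul (B (p⁻¹ • X)) _ k', inner_sub_right, inner_smul_right, hXk, mul_one,
      sub_self]

/-- The linear map `ℝ³ → V` sending the standard basis to `X`, `Y`, `k`. -/
def linearOfColumns {V : Type*} [NormedAddCommGroup V] [NormedSpace ℝ V] (X Y k : V) :
    EuclideanSpace ℝ (Fin 3) →L[ℝ] V :=
  (EuclideanSpace.proj 0).smulRight X + (EuclideanSpace.proj 1).smulRight Y +
    (EuclideanSpace.proj 2).smulRight k

theorem linearOfColumns_apply {V : Type*} [NormedAddCommGroup V] [NormedSpace ℝ V] (X Y k : V)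
    (p : EuclideanSpace ℝ (Fin 3)) :
    linearOfColumns X Y k p = p 0 • X + p 1 • Y + p 2 • k := by
  simp [linearOfColumns]

theorem linearOfColumns_apply_apply_of_symm {V W : Type*} [NormedAddCommGroup V]
    [NormedSpace ℝ V] [NormedAddCommGroup W] [NormedSpace ℝ W] (B : V →L[ℝ] V →L[ℝ] W)
    (hB : ∀ u v, B u v = B v u) (X Y k : V) (p : EuclideanSpace ℝ (Fin 3)) :
    B (linearOfColumns X Y k p) (linearOfColumns X Y k p) =
      p 0 ^ 2 • B X X + p 1 ^ 2 • B Y Y + p 2 ^ 2 • B k k +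
        (2 * p 0 * p 1) • B X Y + (2 * p 0 * p 2) • B X k + (2 * p 1 * p 2) • B Y k := by
  simp only [linearOfColumns_apply, map_add, map_smul, add_apply, smul_apply,
    hB Y X, hB k X, hB k Y]
  module

/-- The bilinear map `(u, v) ↦ C (B (M u) (M v))`. -/
def conjBilinear {U V W Z : Type*} [NormedAddCommGroup U] [NormedSpace ℝ U]
    [NormedAddCommGroup V] [NormedSpace ℝ V] [NormedAddCommGroup W] [NormedSpace ℝ W]
    [NormedAddCommGroup Z] [NormedSpace ℝ Z]
    (C : W →L[ℝ] Z) (B : V →L[ℝ] V →L[ℝ] W) (M : U →L[ℝ] V) : U →L[ℝ] U →L[ℝ] Z :=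
  (ContinuousLinearMap.compL ℝ U W Z C).comp (B.bilinearComp M M)

theorem conjBilinear_apply {U V W Z : Type*} [NormedAddCommGroup U] [NormedSpace ℝ U]
    [NormedAddCommGroup V] [NormedSpace ℝ V] [NormedAddCommGroup W] [NormedSpace ℝ W]
    [NormedAddCommGroup Z] [NormedSpace ℝ Z]
    (C : W →L[ℝ] Z) (B : V →L[ℝ] V →L[ℝ] W) (M : U →L[ℝ] V) (u v : U) :
    conjBilinear C B M u v = C (B (M u) (M v)) := rfl

/-- The 2-jet of `A ∘ f ∘ ψ` for linear `A` and `ψ` with linear part `M` and quadratic part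
`p ↦ ½ C (D²f(0)(M p, M p))`. -/
theorem iteratedFDeriv_comp_comp_quadraticMap {U V W Z : Type*}
    [NormedAddCommGroup U] [NormedSpace ℝ U] [NormedAddCommGroup V] [NormedSpace ℝ V]
    [NormedAddCommGroup W] [NormedSpace ℝ W] [NormedAddCommGroup Z] [NormedSpace ℝ Z]
    {f : V → W} (hf : ContDiff ℝ 2 f) (h0 : f 0 = 0) (A : W →L[ℝ] Z) (M : U →L[ℝ] V)
    (C : W →L[ℝ] V) {n : ℕ} (hn : n ≤ 2) :
    iteratedFDeriv ℝ n (A ∘ f ∘ quadraticMap M (conjBilinear C (fderiv ℝ (fderiv ℝ f) 0) M)) 0 =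
      iteratedFDeriv ℝ n (quadraticMap (A.comp ((fderiv ℝ f 0).comp M))
        (conjBilinear (A.comp (.id ℝ W + (fderiv ℝ f 0).comp C))
          (fderiv ℝ (fderiv ℝ f) 0) M)) 0 := by
  set L := fderiv ℝ f 0
  set B := fderiv ℝ (fderiv ℝ f) 0
  have hsymm : ∀ u v, B u v = B v u := fun u v =>
    (hf.contDiffAt.isSymmSndFDerivAt (by simp)).eq u v
  set N := conjBilinear C B M
  have hψd : HasFDerivAt (quadraticMap M N) M 0 := by
    simpa using hasFDerivAt_quadraticMap M N 0
  have hψ0 : quadraticMap M N 0 = 0 := by simp [quadraticMap]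
  have hψ : ContDiff ℝ 2 (quadraticMap M N) := contDiff_quadraticMap M N
  have hfψ : ContDiff ℝ 2 (f ∘ quadraticMap M N) := hf.comp hψ
  have hfψd : fderiv ℝ (f ∘ quadraticMap M N) 0 = L.comp M := by
    rw [fderiv_comp 0 ((hf.differentiable (by norm_num)) _) hψd.differentiableAt, hψ0,
      hψd.fderiv]
  have hA2 : fderiv ℝ (fderiv ℝ A) 0 = 0 := by
    rw [show fderiv ℝ A = fun _ => A from funext fun _ => A.fderiv]
    simp
  refine iteratedFDeriv_eq_of_le_two_iff.2 ⟨by simp [quadraticMap, h0], fun u => ?_,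
    fun u v => ?_⟩ n hn
  · rw [fderiv_comp 0 A.differentiableAt ((hfψ.differentiable (by norm_num)) _), hfψd,
      A.fderiv, (hasFDerivAt_quadraticMap _ _ _).fderiv]
    simp
  · rw [fderiv_fderiv_comp A.contDiff hfψ, fderiv_fderiv_comp hf hψ,
      fderiv_fderiv_quadraticMap, fderiv_fderiv_quadraticMap, A.fderiv, Function.comp_apply,
      hψ0, h0, hA2, hψd.fderiv]
    simp only [N, conjBilinear_apply, hsymm (M v) (M u), ← two_smul ℝ, smul_smul]
    norm_num
    rfl

/-- The linear map `w ↦ -(⟪b 0, w⟫ X + ⟪b 1, w⟫ Y)`; when `X` and `Y` are preimages of `b 0` and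
`b 1`, it removes the tangential part of a second-order term. -/
def tangentialCorrection {V W : Type*} [NormedAddCommGroup V] [NormedSpace ℝ V]
    [NormedAddCommGroup W] [InnerProductSpace ℝ W] (b : OrthonormalBasis (Fin 5) ℝ W) (X Y : V) :
    W →L[ℝ] V :=
  -((innerSL ℝ (b 0)).smulRight X + (innerSL ℝ (b 1)).smulRight Y)

theorem inner_add_map_tangentialCorrection {V W : Type*} [NormedAddCommGroup V] [NormedSpace ℝ V]
    [NormedAddCommGroup W] [InnerProductSpace ℝ W] (b : OrthonormalBasis (Fin 5) ℝ W)
    {L : V →L[ℝ] W} {X Y : V} (hX : L X = b 0) (hY : L Y = b 1) (w : W) (i : Fin 5) :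
    inner ℝ (b i) (w + L (tangentialCorrection b X Y w)) =
      if i = 0 ∨ i = 1 then 0 else inner ℝ (b i) w := by
  have hb := orthonormal_iff_ite.1 b.orthonormal
  have h : L (tangentialCorrection b X Y w) =
      -(inner ℝ (b 0) w • b 0 + inner ℝ (b 1) w • b 1) := by
    simp [tangentialCorrection, hX, hY]
  rw [h, inner_add_right, inner_neg_right, inner_add_right, inner_smul_right, inner_smul_right,
    hb, hb]
  rcases eq_or_ne i 0 with rfl | h0
  · simp
  rcases eq_or_ne i 1 with rfl | h1
  · simp
  simp [h0, h1]

/-- Any germ `𝒜²`-equivalent to the cross-cap can be put, by a change of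
coordinates in the source and a linear isometry of the target, into the special
normal form of Proposition 3.11(a), at the level of 2-jets. -/
theorem normal_form_under_R2_O5 (f : EuclideanSpace ℝ (Fin 3) → EuclideanSpace ℝ (Fin 5))
    (hf : ContDiff ℝ (⊤ : ℕ∞) f) (h0 : f 0 = 0) (hA2 : A2Equiv f g1) :
    ∃ (ψ : EuclideanSpace ℝ (Fin 3) → EuclideanSpace ℝ (Fin 3))
      (ψ' : EuclideanSpace ℝ (Fin 3) ≃L[ℝ] EuclideanSpace ℝ (Fin 3))
      (A : EuclideanSpace ℝ (Fin 5) ≃ₗᵢ[ℝ] EuclideanSpace ℝ (Fin 5))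
      (a₁ a₃ a₆ b₁ b₂ b₃ b₆ c₁ c₂ c₃ c₄ c₅ c₆ : ℝ),
      ContDiff ℝ (⊤ : ℕ∞) ψ ∧ ψ 0 = 0 ∧
      HasFDerivAt ψ (ψ' : EuclideanSpace ℝ (Fin 3) →L[ℝ] EuclideanSpace ℝ (Fin 3)) 0 ∧
      c₄ > 0 ∧ b₆ ≠ 0 ∧
      ∀ k : ℕ, k ≤ 2 →
        iteratedFDeriv ℝ k (A ∘ f ∘ ψ) 0 =
        iteratedFDeriv ℝ k (fun p : EuclideanSpace ℝ (Fin 3) =>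
          ((WithLp.equiv 2 (Fin 5 → ℝ)).symm
            ![p 0, p 1,
              a₁ * p 0 ^ 2 + a₃ * p 1 ^ 2 + p 0 * p 2 + a₆ * p 1 * p 2,
              b₁ * p 0 ^ 2 + b₂ * p 0 * p 1 + b₃ * p 1 ^ 2 + b₆ * p 1 * p 2,
              c₁ * p 0 ^ 2 + c₂ * p 0 * p 1 + c₃ * p 1 ^ 2 + c₄ * p 2 ^ 2
                + c₅ * p 0 * p 2 + c₆ * p 1 * p 2] : EuclideanSpace ℝ (Fin 5))) 0 := by
  have hf2 : ContDiff ℝ 2 f := contDiff_infty.1 hf 2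
  obtain ⟨X₀, Y₀, k₀, hk₀, hli⟩ := hA2.exists_linearIndependent hf2 h0
  set L := fderiv ℝ f 0
  set B := fderiv ℝ (fderiv ℝ f) 0
  have hsymm : ∀ u v, B u v = B v u := fun u v =>
    (hf2.contDiffAt.isSymmSndFDerivAt (by simp)).eq u v
  obtain ⟨b, X, Y, k, hX, hY, hk, b2Xk, b3Xk, b3Yk, b2kk, b3kk, b4kk, b2XY⟩ :=
    exists_adapted_orthonormalBasis finrank_euclideanSpace_fin L B hk₀ hli
  set M := linearOfColumns X Y k with hM
  have hLM : ∀ p, L (M p) = p 0 • b 0 + p 1 • b 1 := fun p => by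
    simp [hM, linearOfColumns_apply, hX, hY, hk]
  have hinner : ∀ i j, inner ℝ (b i) (b j) = if i = j then 1 else 0 :=
    orthonormal_iff_ite.1 b.orthonormal
  have hk0 : k ≠ 0 := by
    rintro rfl
    simp at b4kk
  have hMinj : Function.Injective M := by
    rw [injective_iff_map_eq_zero]
    intro p hp
    have h := hLM p
    rw [hp, map_zero] at h
    have p0 : p 0 = 0 := by
      simpa [inner_add_right, inner_smul_right, hinner] using (congrArg (inner ℝ (b 0)) h).symm
    have p1 : p 1 = 0 := by
      simpa [inner_add_right, inner_smul_right, hinner] using (congrArg (inner ℝ (b 1)) h).symm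
    have p2 : p 2 = 0 := by
      simpa [hM, linearOfColumns_apply, p0, p1, hk0] using hp
    ext i
    fin_cases i <;> simp [p0, p1, p2]
  let M' : EuclideanSpace ℝ (Fin 3) ≃L[ℝ] EuclideanSpace ℝ (Fin 3) :=
    (LinearEquiv.ofInjectiveEndo M.toLinearMap hMinj).toContinuousLinearEquiv
  have hM' : (M' : EuclideanSpace ℝ (Fin 3) →L[ℝ] EuclideanSpace ℝ (Fin 3)) = M := by
    ext p
    rfl
  let A : EuclideanSpace ℝ (Fin 5) →L[ℝ] EuclideanSpace ℝ (Fin 5) :=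
    b.repr.toContinuousLinearEquiv.toContinuousLinearMap
  refine ⟨quadraticMap M (conjBilinear (tangentialCorrection b X Y) B M), M', b.repr,
    inner ℝ (b 2) (B X X) / 2, inner ℝ (b 2) (B Y Y) / 2, inner ℝ (b 2) (B Y k),
    inner ℝ (b 3) (B X X) / 2, inner ℝ (b 3) (B X Y), inner ℝ (b 3) (B Y Y) / 2,
    inner ℝ (b 3) (B Y k),
    inner ℝ (b 4) (B X X) / 2, inner ℝ (b 4) (B X Y), inner ℝ (b 4) (B Y Y) / 2,
    inner ℝ (b 4) (B k k) / 2, inner ℝ (b 4) (B X k), inner ℝ (b 4) (B Y k),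
    contDiff_quadraticMap _ _, by simp [quadraticMap], ?_, half_pos b4kk, b3Yk, fun n hn => ?_⟩
  · rw [hM']
    simpa using hasFDerivAt_quadraticMap M (conjBilinear (tangentialCorrection b X Y) B M) 0
  refine (iteratedFDeriv_comp_comp_quadraticMap hf2 h0 A M _ hn).trans ?_
  congr 1
  ext p i
  have hBi : inner ℝ (b i) (B (M p) (M p)) = p 0 ^ 2 * inner ℝ (b i) (B X X) +
      p 1 ^ 2 * inner ℝ (b i) (B Y Y) + p 2 ^ 2 * inner ℝ (b i) (B k k) +
      2 * p 0 * p 1 * inner ℝ (b i) (B X Y) + 2 * p 0 * p 2 * inner ℝ (b i) (B X k) +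
      2 * p 1 * p 2 * inner ℝ (b i) (B Y k) := by
    rw [hM, linearOfColumns_apply_apply_of_symm B hsymm]
    simp only [inner_add_right, inner_smul_right]
  have hcoord : quadraticMap (A.comp (L.comp M))
      (conjBilinear (A.comp (.id ℝ _ + L.comp (tangentialCorrection b X Y))) B M) p i =
      inner ℝ (b i) (L (M p)) + 1 / 2 * inner ℝ (b i)
        (B (M p) (M p) + L (tangentialCorrection b X Y (B (M p) (M p)))) := by
    simp only [← OrthonormalBasis.repr_apply_apply]
    rfl
  rw [hcoord, inner_add_map_tangentialCorrection b hX hY, hBi, hLM, inner_add_right,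
    inner_smul_right, inner_smul_right, hinner, hinner]
  match i with
  | 0 => simp
  | 1 => simp
  | 2 =>
    simp [b2Xk, b2kk, b2XY]
    ring
  | 3 =>
    simp [b3Xk, b3kk]
    ring
  | 4 =>
    simp
    ring
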